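/- arXiv:cs/0201001 — 3 statements merged into one kernel-verified Lean document; each statement's English description precedes it below -/
import Mathlib

section
/- For every prime p and every constant C₁ > 0 there exist a constant C₂ > 0 and N₀ such that the following holds for every even n ≥ N₀ and every m with n² ≤ m ≤ 10n². Let μ_1,…,μ_m be linear forms on M_n(GF(p)) such that μ_1,…,μ_{n²} are linearly independent, at least n² − C₁·n^(5/3) of the forms μ_1,…,μ_{n²} vanish on the identity matrix I, and at least (m − n²)/p − C₁·n^(5/3) of the forms μ_{n²+1},…,μ_m vanish on I. Then there exist two matrices a, b ∈ M_n(GF(p)) such that the commutator [a,b] = ab − ba is invertible and the number of indices i ∈ {1,…,m} such that μ_i vanishes on each of I, a and b is at least (1 − 1/p³)·n² + m/p³ − C₂·n^(7/4). -/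
open MvPolynomial in
/-- A polynomial over a finite field that is not identically zero as a function has a nonzero
value at a point whose support is at most its total degree. -/
lemma exists_eval_ne_zero_card_support_le {K σ : Type*} [Field K] [Fintype K] [DecidableEq K]
    [Fintype σ] (P : MvPolynomial σ K) (hP : ∃ x, eval x P ≠ 0) :
    ∃ x, eval x P ≠ 0 ∧ (Finset.univ.filter fun j => x j ≠ 0).card ≤ P.totalDegree := by
  classical
  obtain ⟨y, hy, hmin⟩ := exists_minimalFor_of_wellFoundedLT (fun x => eval x P ≠ 0)
    (fun x : σ → K => (Finset.univ.filter fun j => x j ≠ 0).card) hP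
  refine ⟨y, hy, ?_⟩
  by_contra! hlt
  set q := Fintype.card K with hq
  have hq2 : 2 ≤ q := Fintype.one_lt_card
  let g : σ → MvPolynomial σ K := fun j =>
    if y j = 0 then 1 - X j ^ (q - 1) else ∏ c ∈ Finset.univ \ {0, y j}, (X j - C c)
  have hg_deg (j : σ) : (g j).totalDegree + (if y j ≠ 0 then 1 else 0) ≤ q - 1 := by
    by_cases h : y j = 0
    · simp only [g, h, if_true, ne_eq, not_true_eq_false, if_false, add_zero]
      refine (totalDegree_sub _ _).trans ?_
      simp
    · simp only [g, h, if_false, ne_eq, not_false_eq_true, if_true]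
      have h1 : (∏ c ∈ Finset.univ \ {0, y j}, (X j - C c) : MvPolynomial σ K).totalDegree
          ≤ q - 2 := by
        refine (totalDegree_finsetProd _ _).trans ?_
        refine (Finset.sum_le_card_nsmul _ _ 1 fun c _ => ?_).trans ?_
        · exact (totalDegree_sub_C_le _ _).trans (totalDegree_X _).le
        · rw [Finset.card_sdiff_of_subset (Finset.subset_univ _),
            Finset.card_pair (Ne.symm h), Finset.card_univ]
          simp [hq]
      omega
  have hg_zero {x : σ → K} {j : σ} (h : eval x (g j) ≠ 0) : x j = 0 ∨ x j = y j := by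
    by_cases h0 : y j = 0
    · simp only [g, h0, if_true, map_sub, map_one, map_pow, eval_X] at h
      left
      by_contra hx
      exact h (by rw [hq, FiniteField.pow_card_sub_one_eq_one _ hx, sub_self])
    · simp only [g, h0, if_false, map_prod, map_sub, eval_X, eval_C] at h
      by_contra! hx
      exact h (Finset.prod_eq_zero (i := x j) (by simp [hx.1, hx.2]) (sub_self _))
  have hg_self (j : σ) : eval y (g j) ≠ 0 := by
    by_cases h0 : y j = 0
    · simp only [g, h0, if_true, map_sub, map_one, map_pow, eval_X]
      rw [zero_pow (by omega)]
      simp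
    · simp only [g, h0, if_false, map_prod, map_sub, eval_X, eval_C]
      refine Finset.prod_ne_zero_iff.2 fun c hc => sub_ne_zero.2 ?_
      rintro rfl
      simp at hc
  have hdeg : (P * ∏ j, g j).totalDegree < (q - 1) * Fintype.card σ := by
    have h1 : ∑ j, ((g j).totalDegree + (if y j ≠ 0 then 1 else 0)) ≤ (q - 1) * Fintype.card σ := by
      refine (Finset.sum_le_card_nsmul _ _ (q - 1) fun j _ => hg_deg j).trans ?_
      simp [mul_comm]
    rw [Finset.sum_add_distrib, ← Finset.card_filter] at h1
    have h2 := totalDegree_mul P (∏ j, g j)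
    have h3 : (∏ j, g j).totalDegree ≤ ∑ j, (g j).totalDegree := totalDegree_finsetProd _ g
    omega
  have hsum := sum_eval_eq_zero _ hdeg
  rw [Finset.sum_eq_single y] at hsum
  · rw [map_mul, map_prod] at hsum
    exact mul_ne_zero hy (Finset.prod_ne_zero_iff.2 fun j _ => hg_self j) hsum
  · intro x _ hxy
    by_contra hx
    rw [map_mul, map_prod] at hx
    have hxg (j : σ) : x j = 0 ∨ x j = y j :=
      hg_zero (Finset.prod_ne_zero_iff.1 (right_ne_zero_of_mul hx) j (Finset.mem_univ j))
    obtain ⟨j, hj⟩ := Function.ne_iff.1 hxy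
    have hss : (Finset.univ.filter fun j => x j ≠ 0) ⊂ Finset.univ.filter fun j => y j ≠ 0 := by
      refine Finset.ssubset_iff_of_subset (fun i hi => ?_) |>.2 ⟨j, ?_, ?_⟩
      · have := hxg i
        simp only [Finset.mem_filter, Finset.mem_univ, true_and] at hi ⊢
        grind
      · have := hxg j
        simp only [Finset.mem_filter, Finset.mem_univ, true_and]
        grind
      · have := hxg j
        simp only [Finset.mem_filter, Finset.mem_univ, true_and]
        grind
    have := hmin (left_ne_zero_of_mul hx) (Finset.card_le_card hss.subset)
    exact absurd (Finset.card_lt_card hss) this.not_gt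
  · simp

/-- The total degree of a determinant of polynomials of total degree at most `d`. -/
lemma MvPolynomial.totalDegree_det_le {R σ ι : Type*} [CommRing R] [Fintype ι] [DecidableEq ι]
    (A : Matrix ι ι (MvPolynomial σ R)) {d : ℕ} (hA : ∀ i j, (A i j).totalDegree ≤ d) :
    A.det.totalDegree ≤ Fintype.card ι * d := by
  rw [Matrix.det_apply]
  refine totalDegree_finsetSum_le fun s _ => ?_
  rw [Units.smul_def]
  refine (totalDegree_smul_le _ _).trans ((totalDegree_finsetProd _ _).trans ?_)
  exact (Finset.sum_le_card_nsmul _ _ d fun i _ => hA _ _).trans (by simp)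

/-- Over a finite prime field there are two `D`-dimensional spaces of matrices of size `2k`,
`D ≤ k`, such that nonzero members of the two spaces have an invertible commutator. -/
lemma exists_isUnit_commutator_of_ne_zero (p : ℕ) [Fact p.Prime] {k D : ℕ} (hk : k ≠ 0)
    (hD : D ≤ k) : ∃ X Y : Fin D → Matrix (Fin (k + k)) (Fin (k + k)) (ZMod p),
      ∀ c c' : Fin D → ZMod p, c ≠ 0 → c' ≠ 0 →
        IsUnit ((∑ j, c j • X j) * (∑ j, c' j • Y j) - (∑ j, c' j • Y j) * (∑ j, c j • X j)) := by
  let b : Module.Basis (Fin k) (ZMod p) (GaloisField p k) :=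
    Module.finBasisOfFinrankEq _ _ (GaloisField.finrank p hk)
  let β := Algebra.leftMulMatrix b
  let w : Fin D → GaloisField p k := fun j => b (Fin.castLE hD j)
  have hw : LinearIndependent (ZMod p) w :=
    b.linearIndependent.comp _ (Fin.castLE_injective hD)
  have hwne (c : Fin D → ZMod p) (hc : c ≠ 0) : ∑ j, c j • w j ≠ 0 := fun h =>
    hc (funext (Fintype.linearIndependent_iff.1 hw c h))
  let r := Matrix.reindexAlgEquiv (ZMod p) (ZMod p) (finSumFinEquiv (m := k) (n := k))
  refine ⟨fun j => r (Matrix.fromBlocks (β (w j)) 0 0 0),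
    fun j => r (Matrix.fromBlocks 0 (β (w j)) (β (w j)) 0), fun c c' hc hc' => ?_⟩
  have hX : ∑ j, c j • r (Matrix.fromBlocks (β (w j)) 0 0 0) =
      r (Matrix.fromBlocks (β (∑ j, c j • w j)) 0 0 0) := by
    have : Matrix.fromBlocks (β (∑ j, c j • w j)) 0 0 (0 : Matrix (Fin k) (Fin k) (ZMod p)) =
        ∑ j, c j • Matrix.fromBlocks (β (w j)) 0 0 0 := by
      ext (i | i) (l | l) <;> simp [Matrix.sum_apply]
    rw [this, map_sum]
    simp
  have hY : ∑ j, c' j • r (Matrix.fromBlocks 0 (β (w j)) (β (w j)) 0) =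
      r (Matrix.fromBlocks 0 (β (∑ j, c' j • w j)) (β (∑ j, c' j • w j)) 0) := by
    have : Matrix.fromBlocks (0 : Matrix (Fin k) (Fin k) (ZMod p)) (β (∑ j, c' j • w j))
        (β (∑ j, c' j • w j)) 0 = ∑ j, c' j • Matrix.fromBlocks 0 (β (w j)) (β (w j)) 0 := by
      ext (i | i) (l | l) <;> simp [Matrix.sum_apply]
    rw [this, map_sum]
    simp
  rw [hX, hY, ← map_mul, ← map_mul, ← map_sub]
  refine IsUnit.map r ?_
  have hu := ((IsUnit.mk0 _ (hwne c hc)).mul (IsUnit.mk0 _ (hwne c' hc'))).map β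
  set u := ∑ j, c j • w j
  set v := ∑ j, c' j • w j
  have : Matrix.fromBlocks (β u) 0 0 0 * Matrix.fromBlocks 0 (β v) (β v) 0 -
      Matrix.fromBlocks 0 (β v) (β v) 0 * Matrix.fromBlocks (β u) 0 0 0 =
      Matrix.fromBlocks 0 (β (u * v)) (-β (u * v)) 0 := by
    simp [Matrix.fromBlocks_multiply, Matrix.fromBlocks_neg, sub_eq_add_neg,
      Matrix.fromBlocks_add, mul_comm v u, ← map_mul]
  rw [this]
  obtain ⟨z, hz⟩ := hu
  rw [← hz]
  refine IsUnit.of_mul_eq_one (Matrix.fromBlocks 0 (-(↑z⁻¹ : Matrix _ _ _)) (↑z⁻¹) 0) ?_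
  simp [Matrix.fromBlocks_multiply]

open MvPolynomial in
/-- If all nonzero linear combinations of some matrices `X j` and of some matrices `Y j` have
invertible commutators, then such matrices exist with few nonzero coordinates
in a given basis. -/
lemma exists_isUnit_commutator_card_support_le {K ι ν κ : Type*} [Field K] [Fintype K]
    [DecidableEq K] [Fintype ι] [Fintype ν] [DecidableEq ν] [Fintype κ] [DecidableEq κ]
    (e : Module.Basis ι K (Matrix ν ν K))
    (h : ∃ X Y : κ → Matrix ν ν K, ∀ c c' : κ → K, c ≠ 0 → c' ≠ 0 →
      IsUnit ((∑ j, c j • X j) * (∑ j, c' j • Y j) - (∑ j, c' j • Y j) * (∑ j, c j • X j))) :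
    ∃ X Y : κ → Matrix ν ν K, (∀ c c' : κ → K, c ≠ 0 → c' ≠ 0 →
      IsUnit ((∑ j, c j • X j) * (∑ j, c' j • Y j) - (∑ j, c' j • Y j) * (∑ j, c j • X j))) ∧
      (Finset.univ.filter fun i => ∃ j, e.repr (X j) i ≠ 0 ∨ e.repr (Y j) i ≠ 0).card ≤
        2 * Fintype.card ν * Fintype.card K ^ (2 * Fintype.card κ) := by
  classical
  let G : Bool → (κ → K) → Matrix ν ν (MvPolynomial ((Bool × κ) × ι) K) := fun s c =>
    Matrix.of fun u v => ∑ j, ∑ i, C (c j * e i u v) * X ((s, j), i)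
  let Q : (κ → K) × (κ → K) → Matrix ν ν (MvPolynomial ((Bool × κ) × ι) K) := fun d =>
    G false d.1 * G true d.2 - G true d.2 * G false d.1
  let S : Finset ((κ → K) × (κ → K)) := Finset.univ.filter fun d => d.1 ≠ 0 ∧ d.2 ≠ 0
  let P := ∏ d ∈ S, (Q d).det
  let Z : ((Bool × κ) × ι → K) → Bool → κ → Matrix ν ν K := fun x s j => ∑ i, x ((s, j), i) • e i
  have hG (x : (Bool × κ) × ι → K) (s : Bool) (c : κ → K) :
      (eval x).mapMatrix (G s c) = ∑ j, c j • Z x s j := by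
    ext u v
    simp [G, Z, Matrix.sum_apply, Finset.mul_sum, mul_comm, mul_left_comm]
  have hP (x : (Bool × κ) × ι → K) : eval x P ≠ 0 ↔ ∀ c c' : κ → K, c ≠ 0 → c' ≠ 0 →
      IsUnit ((∑ j, c j • Z x false j) * (∑ j, c' j • Z x true j) -
        (∑ j, c' j • Z x true j) * (∑ j, c j • Z x false j)) := by
    simp only [P, Q, map_prod, RingHom.map_det, map_sub, map_mul, hG, Finset.prod_ne_zero_iff,
      Matrix.isUnit_iff_isUnit_det, isUnit_iff_ne_zero, S, Prod.forall, Finset.mem_filter,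
      Finset.mem_univ, true_and, and_imp]
  have hGdeg (s : Bool) (c : κ → K) (u v : ν) : (G s c u v).totalDegree ≤ 1 := by
    refine totalDegree_finsetSum_le fun j _ => totalDegree_finsetSum_le fun i _ => ?_
    refine (totalDegree_mul _ _).trans ?_
    rw [totalDegree_C, totalDegree_X]
  have hGG (s s' : Bool) (c c' : κ → K) (u v : ν) :
      ((G s c * G s' c') u v).totalDegree ≤ 2 :=
    totalDegree_finsetSum_le fun l _ =>
      (totalDegree_mul _ _).trans (add_le_add (hGdeg _ _ _ _) (hGdeg _ _ _ _))
  have hPdeg : P.totalDegree ≤ 2 * Fintype.card ν * Fintype.card K ^ (2 * Fintype.card κ) := by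
    refine (totalDegree_finsetProd _ _).trans ?_
    refine (Finset.sum_le_card_nsmul _ _ (Fintype.card ν * 2) fun d _ =>
      totalDegree_det_le _ fun u v => ?_).trans ?_
    · exact (totalDegree_sub _ _).trans (max_le (hGG _ _ _ _ _ _) (hGG _ _ _ _ _ _))
    · rw [smul_eq_mul, mul_comm, mul_comm 2 (Fintype.card ν)]
      refine Nat.mul_le_mul_left _ ((Finset.card_le_univ _).trans ?_)
      simp [← pow_add, two_mul]
  obtain ⟨X₀, Y₀, h₀⟩ := h
  obtain ⟨x, hx, hcard⟩ := exists_eval_ne_zero_card_support_le P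
    ⟨fun t => e.repr (if t.1.1 then Y₀ t.1.2 else X₀ t.1.2) t.2, by
      rw [hP]
      simpa [Z, e.sum_repr] using h₀⟩
  have hrepr (s : Bool) (j : κ) (i : ι) : e.repr (Z x s j) i = x ((s, j), i) := by
    simp [Z, Finsupp.single_apply]
  refine ⟨Z x false, Z x true, (hP x).1 hx, le_trans ?_ (hcard.trans hPdeg)⟩
  simp only [hrepr]
  refine (Finset.card_le_card fun i hi => ?_).trans
    (Finset.card_image_le (f := fun t : (Bool × κ) × ι => t.2))
  simp only [Finset.mem_filter, Finset.mem_univ, true_and, Finset.mem_image] at hi ⊢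
  obtain ⟨j, hj | hj⟩ := hi
  exacts [⟨_, hj, rfl⟩, ⟨_, hj, rfl⟩]

/-- A linear form on `K ^ κ` has at least `|K| ^ (|κ| - 1) - 1` nontrivial zeros. -/
lemma card_ne_zero_filter_apply_eq_zero_ge {K κ : Type*} [Field K] [Fintype K] [DecidableEq K]
    [Fintype κ] [DecidableEq κ] (f : (κ → K) →ₗ[K] K) :
    Fintype.card K ^ (Fintype.card κ - 1) - 1 ≤
      (Finset.univ.filter fun c : κ → K => c ≠ 0 ∧ f c = 0).card := by
  have h1 := f.finrank_range_add_finrank_ker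
  have h2 : Module.finrank K (LinearMap.range f) ≤ 1 := by
    simpa using Submodule.finrank_le (LinearMap.range f)
  rw [Module.finrank_fintype_fun_eq_card] at h1
  have h3 : (Finset.univ.filter fun c : κ → K => f c = 0).card =
      Fintype.card K ^ Module.finrank K (LinearMap.ker f) := by
    rw [← Nat.card_eq_fintype_card (α := K), ← Module.natCard_eq_pow_finrank,
      ← Nat.subtype_card _ (p := fun c => c ∈ LinearMap.ker f) (by simp)]
  have h4 : (Finset.univ.filter fun c : κ → K => c ≠ 0 ∧ f c = 0) =
      (Finset.univ.filter fun c : κ → K => f c = 0).erase 0 := by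
    ext c
    simp
  rw [h4, Finset.card_erase_of_mem (by simp), h3]
  exact Nat.sub_le_sub_right (Nat.pow_le_pow_right Fintype.card_pos (by omega)) 1

/-- For linear forms `f i`, `g i` on `K ^ κ`, `i ∈ E`, some nonzero vectors `c`, `c'` are zeros of
both `f i` and `g i` for at least the average number of `i`. -/
lemma exists_ne_zero_card_filter_ge {K κ ι : Type*} [Field K] [Fintype K] [DecidableEq K]
    [Fintype κ] [DecidableEq κ] [Nonempty κ] (E : Finset ι) (f g : ι → (κ → K) →ₗ[K] K) :
    ∃ c c' : κ → K, c ≠ 0 ∧ c' ≠ 0 ∧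
      E.card * (Fintype.card K ^ (Fintype.card κ - 1) - 1) ^ 2 ≤
        (Fintype.card K ^ Fintype.card κ - 1) ^ 2 *
          (E.filter fun i => f i c = 0 ∧ g i c' = 0).card := by
  classical
  let V : Finset (κ → K) := Finset.univ.filter fun c => c ≠ 0
  have hV : V.card = Fintype.card K ^ Fintype.card κ - 1 := by
    have : V = Finset.univ.erase 0 := by ext; simp [V]
    rw [this, Finset.card_erase_of_mem (Finset.mem_univ _)]
    simp
  have hne : V.Nonempty := ⟨1, by simp [V]⟩
  have hsum : E.card * (Fintype.card K ^ (Fintype.card κ - 1) - 1) ^ 2 ≤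
      ∑ d ∈ V ×ˢ V, (E.filter fun i => f i d.1 = 0 ∧ g i d.2 = 0).card := by
    simp only [Finset.card_filter _ E]
    rw [Finset.sum_comm, ← smul_eq_mul]
    refine Finset.card_nsmul_le_sum _ _ _ fun i _ => ?_
    rw [← Finset.card_filter,
      Finset.filter_product (fun c => f i c = 0) (fun c => g i c = 0), Finset.card_product, sq]
    simp only [V, Finset.filter_filter]
    exact Nat.mul_le_mul (card_ne_zero_filter_apply_eq_zero_ge _)
      (card_ne_zero_filter_apply_eq_zero_ge _)
  obtain ⟨d, hd, hle⟩ := Finset.exists_max_image (V ×ˢ V)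
    (fun d => (E.filter fun i => f i d.1 = 0 ∧ g i d.2 = 0).card) (hne.product hne)
  refine ⟨d.1, d.2, by simpa [V] using (Finset.mem_product.1 hd).1,
    by simpa [V] using (Finset.mem_product.1 hd).2, hsum.trans ?_⟩
  refine (Finset.sum_le_card_nsmul _ _ _ hle).trans ?_
  rw [Finset.card_product, hV, sq, smul_eq_mul]

/-- A linearly independent family of linear forms of full size is the family of coordinates of
some basis. -/
lemma exists_basis_repr_eq_apply {K V ι : Type*} [Field K] [AddCommGroup V] [Module K V]
    [FiniteDimensional K V] [Fintype ι] (f : ι → V →ₗ[K] K) (hf : LinearIndependent K f)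
    (hcard : Fintype.card ι = Module.finrank K V) :
    ∃ e : Module.Basis ι K V, ∀ x i, e.repr x i = f i x := by
  have hspan : Submodule.span K (Set.range f) = ⊤ :=
    hf.span_eq_top_of_card_eq_finrank' (by rw [hcard]; exact Subspace.dual_finrank_eq.symm)
  have hinj : Function.Injective (LinearMap.pi f) := by
    refine (injective_iff_map_eq_zero _).2 fun x hx => ?_
    refine (Module.forall_dual_apply_eq_zero_iff K x).1 fun φ => ?_
    have hφ : φ ∈ Submodule.span K (Set.range f) := hspan ▸ Submodule.mem_top
    have hle : Submodule.span K (Set.range f) ≤ LinearMap.ker (Module.Dual.eval K V x) := by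
      rw [Submodule.span_le]
      rintro _ ⟨i, rfl⟩
      exact congrFun hx i
    exact hle hφ
  exact ⟨.ofEquivFun (LinearEquiv.ofInjectiveOfFinrankEq (LinearMap.pi f) hinj
    (by simp [hcard])), fun x i => rfl⟩

/-- A quantitative count of the linear forms in a family vanishing on two matrices with invertible
commutator, where `D` is a free parameter. -/
lemma exists_isUnit_commutator_card_vanishing_ge (p : ℕ) [Fact p.Prime] {k D m : ℕ} (hD₀ : D ≠ 0)
    (hD : D ≤ k) (hm : (k + k) ^ 2 ≤ m)
    (μ : Fin m → (Matrix (Fin (k + k)) (Fin (k + k)) (ZMod p) →ₗ[ZMod p] ZMod p))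
    (hμ : LinearIndependent (ZMod p) (fun i : Fin ((k + k) ^ 2) => μ (Fin.castLE hm i))) :
    ∃ a b : Matrix (Fin (k + k)) (Fin (k + k)) (ZMod p), IsUnit (a * b - b * a) ∧
      ∃ N B : ℕ, B ≤ 2 * (k + k) * p ^ (2 * D) ∧
        (Finset.univ.filter fun i : Fin m => (k + k) ^ 2 ≤ i.val ∧ μ i 1 = 0).card *
          (p ^ (D - 1) - 1) ^ 2 ≤ (p ^ D - 1) ^ 2 * N ∧
        (Finset.univ.filter fun i : Fin m => i.val < (k + k) ^ 2 ∧ μ i 1 = 0).card + N ≤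
          (Finset.univ.filter fun i : Fin m => μ i 1 = 0 ∧ μ i a = 0 ∧ μ i b = 0).card + B := by
  classical
  have : NeZero D := ⟨hD₀⟩
  obtain ⟨e, he⟩ := exists_basis_repr_eq_apply _ hμ (by simp [Module.finrank_matrix, sq])
  obtain ⟨X, Y, hXY, hcard⟩ := exists_isUnit_commutator_card_support_le e
    (exists_isUnit_commutator_of_ne_zero p (by omega) hD)
  simp only [he, Fintype.card_fin, ZMod.card] at hcard
  set B := Finset.univ.filter fun i : Fin ((k + k) ^ 2) =>
    ∃ j, μ (Fin.castLE hm i) (X j) ≠ 0 ∨ μ (Fin.castLE hm i) (Y j) ≠ 0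
  let E := Finset.univ.filter fun i : Fin m => (k + k) ^ 2 ≤ i.val ∧ μ i 1 = 0
  let A := Finset.univ.filter fun i : Fin m => i.val < (k + k) ^ 2 ∧ μ i 1 = 0
  obtain ⟨c, c', hc, hc', hN⟩ := exists_ne_zero_card_filter_ge E
    (fun i => μ i ∘ₗ Fintype.linearCombination (ZMod p) X)
    (fun i => μ i ∘ₗ Fintype.linearCombination (ZMod p) Y)
  refine ⟨_, _, hXY c c' hc hc', ?_⟩
  set a := ∑ j, c j • X j
  set b := ∑ j, c' j • Y j
  let E' := E.filter fun i => μ i a = 0 ∧ μ i b = 0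
  have hE' : E.card * (p ^ (D - 1) - 1) ^ 2 ≤ (p ^ D - 1) ^ 2 * E'.card := by
    simpa [E', a, b, Fintype.linearCombination_apply] using hN
  refine ⟨E'.card, B.card, hcard, hE', ?_⟩
  have hdisj : Disjoint A E' := by
    refine Finset.disjoint_left.2 fun i hi hi' => ?_
    simp only [A, E', E, Finset.mem_filter] at hi hi'
    omega
  change A.card + E'.card ≤ _
  rw [← Finset.card_union_of_disjoint hdisj, ← Finset.card_map (Fin.castLEEmb hm) (s := B)]
  refine (Finset.card_le_card fun i hi => ?_).trans (Finset.card_union_le _ _)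
  simp only [A, E', E, B, Finset.mem_union, Finset.mem_filter, Finset.mem_univ, true_and,
    Finset.mem_map] at hi ⊢
  rcases hi with ⟨hi, h1⟩ | ⟨⟨-, h1⟩, ha, hb⟩
  · by_cases h : ∃ j, μ i (X j) ≠ 0 ∨ μ i (Y j) ≠ 0
    · exact Or.inr ⟨⟨i, hi⟩, h, rfl⟩
    · push Not at h
      exact Or.inl ⟨h1, by simp [a, h], by simp [b, h]⟩
  · exact Or.inl ⟨h1, ha, hb⟩

/-- The numerical estimate behind the choice of the dimension parameter. -/
lemma vanishing_count_estimate {P T n m C A E N B G : ℝ} (hP : 2 ≤ P) (hT : P ≤ T) (hn : 1 ≤ n)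
    (hTn : T ^ 4 ≤ n) (hnT : n ≤ (P * T) ^ 4) (hC : 0 ≤ C)
    (hE₀ : 0 ≤ E) (hE₁ : E ≤ 9 * n ^ 2) (hN₀ : 0 ≤ N)
    (hA : n ^ 2 - C * n ^ ((5 : ℝ) / 3) ≤ A)
    (hE : (m - n ^ 2) / P - C * n ^ ((5 : ℝ) / 3) ≤ E)
    (hB : B ≤ 2 * n * T ^ 2) (hN : E * (T / P - 1) ^ 2 ≤ (T - 1) ^ 2 * N) (hG : A + N ≤ G + B) :
    (1 - 1 / P ^ 3) * n ^ 2 + m / P ^ 3 - (2 * C + 2 + 9 * P) * n ^ ((7 : ℝ) / 4) ≤ G := by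
  have hP0 : 0 < P := by linarith
  have hT0 : 0 < T := by linarith
  have hn0 : 0 < n := by linarith
  have hpow : n ^ ((5 : ℝ) / 3) ≤ n ^ ((7 : ℝ) / 4) :=
    Real.rpow_le_rpow_of_exponent_le hn (by norm_num)
  have hpos : 0 < n ^ ((7 : ℝ) / 4) := Real.rpow_pos_of_pos hn0 _
  have hTsq : T ^ 2 ≤ n ^ ((3 : ℝ) / 4) := by
    calc T ^ 2 = (T ^ 4) ^ ((1 : ℝ) / 2) := by
          rw [← Real.sqrt_eq_rpow, show T ^ 4 = (T ^ 2) ^ 2 by ring, Real.sqrt_sq (by positivity)]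
      _ ≤ n ^ ((1 : ℝ) / 2) := Real.rpow_le_rpow (by positivity) hTn (by norm_num)
      _ ≤ n ^ ((3 : ℝ) / 4) := Real.rpow_le_rpow_of_exponent_le hn (by norm_num)
  have hB' : B ≤ 2 * n ^ ((7 : ℝ) / 4) := by
    have : n ^ ((7 : ℝ) / 4) = n * n ^ ((3 : ℝ) / 4) := by
      rw [← Real.rpow_one_add' hn0.le (by norm_num)]
      norm_num
    rw [this]
    nlinarith
  have hnroot : n ^ ((1 : ℝ) / 4) ≤ P * T := by
    calc n ^ ((1 : ℝ) / 4) ≤ ((P * T) ^ 4) ^ ((1 : ℝ) / 4) :=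
          Real.rpow_le_rpow hn0.le hnT (by norm_num)
      _ = P * T := by
          rw [← Real.rpow_natCast, ← Real.rpow_mul (by positivity)]
          norm_num
  have hnsq : n ^ 2 ≤ n ^ ((7 : ℝ) / 4) * (P * T) := by
    calc n ^ 2 = n ^ ((7 : ℝ) / 4) * n ^ ((1 : ℝ) / 4) := by
          rw [← Real.rpow_add hn0, ← Real.rpow_natCast]
          norm_num
      _ ≤ _ := mul_le_mul_of_nonneg_left hnroot hpos.le
  have hNge : E * (1 / P ^ 2 - 1 / T) ≤ N := by
    have h1 : E * (T / P - 1) ^ 2 ≤ T ^ 2 * N :=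
      hN.trans (mul_le_mul_of_nonneg_right (by nlinarith) hN₀)
    have h2 : (1 / P ^ 2 - 1 / T) * T ^ 2 ≤ (T / P - 1) ^ 2 := by
      have : (T / P - 1) ^ 2 - (1 / P ^ 2 - 1 / T) * T ^ 2 = T * (1 - 2 / P) + 1 := by
        field_simp
        ring
      have h3 : 2 / P ≤ 1 := (div_le_one hP0).2 hP
      nlinarith
    have h4 : T ^ 2 * (E * (1 / P ^ 2 - 1 / T)) ≤ T ^ 2 * N := by nlinarith
    exact le_of_mul_le_mul_left h4 (by positivity)
  have hET : E * (1 / T) ≤ 9 * P * n ^ ((7 : ℝ) / 4) := by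
    rw [mul_one_div, div_le_iff₀ hT0]
    nlinarith
  have hEP : (m - n ^ 2) / P ^ 3 - C * n ^ ((7 : ℝ) / 4) ≤ E * (1 / P ^ 2) := by
    have h1 : ((m - n ^ 2) / P - C * n ^ ((5 : ℝ) / 3)) * (1 / P ^ 2) ≤ E * (1 / P ^ 2) :=
      mul_le_mul_of_nonneg_right hE (by positivity)
    have h2 : ((m - n ^ 2) / P - C * n ^ ((5 : ℝ) / 3)) * (1 / P ^ 2) =
        (m - n ^ 2) / P ^ 3 - C * n ^ ((5 : ℝ) / 3) * (1 / P ^ 2) := by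
      field_simp
    have h3 : 1 / P ^ 2 ≤ 1 := (div_le_one (by positivity)).2 (by nlinarith)
    have h4 : C * n ^ ((5 : ℝ) / 3) * (1 / P ^ 2) ≤ C * n ^ ((7 : ℝ) / 4) :=
      (mul_le_of_le_one_right (by positivity) h3).trans (mul_le_mul_of_nonneg_left hpow hC)
    linarith
  have hC' := mul_le_mul_of_nonneg_left hpow hC
  have hsplit : (1 - 1 / P ^ 3) * n ^ 2 + m / P ^ 3 = n ^ 2 + (m - n ^ 2) / P ^ 3 := by ring
  rw [hsplit]
  linarith

/-- If many of the forms vanish on the identity (as quantified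
below), then there are matrices a, b with invertible commutator [a,b] such
that at least (1 − 1/p³)n² + m/p³ − C₂·n^(7/4) forms vanish on I, a and b. -/
theorem exists_pair_invertible_commutator_with_many_vanishing_forms
    (p : ℕ) [Fact p.Prime] (C₁ : ℝ) (hC₁ : 0 < C₁) :
    ∃ C₂ : ℝ, 0 < C₂ ∧ ∃ N₀ : ℕ, ∀ n : ℕ, Even n → N₀ ≤ n →
      ∀ m : ℕ, ∀ hm1 : n ^ 2 ≤ m, m ≤ 10 * n ^ 2 →
      ∀ μ : Fin m → (Matrix (Fin n) (Fin n) (ZMod p) →ₗ[ZMod p] ZMod p),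
      LinearIndependent (ZMod p) (fun i : Fin (n ^ 2) => μ (Fin.castLE hm1 i)) →
      ((Finset.univ.filter fun i : Fin m => i.val < n ^ 2 ∧ μ i 1 = 0).card : ℝ) ≥
        (n : ℝ) ^ 2 - C₁ * (n : ℝ) ^ ((5 : ℝ) / 3) →
      ((Finset.univ.filter fun i : Fin m => n ^ 2 ≤ i.val ∧ μ i 1 = 0).card : ℝ) ≥
        ((m : ℝ) - (n : ℝ) ^ 2) / (p : ℝ) - C₁ * (n : ℝ) ^ ((5 : ℝ) / 3) →
      ∃ a b : Matrix (Fin n) (Fin n) (ZMod p), IsUnit (a * b - b * a) ∧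
        ((Finset.univ.filter fun i : Fin m =>
            μ i 1 = 0 ∧ μ i a = 0 ∧ μ i b = 0).card : ℝ) ≥
          (1 - 1 / (p : ℝ) ^ 3) * (n : ℝ) ^ 2 + (m : ℝ) / (p : ℝ) ^ 3
            - C₂ * (n : ℝ) ^ ((7 : ℝ) / 4) := by
  have hp : p.Prime := Fact.out
  refine ⟨2 * C₁ + 2 + 9 * p, by positivity, p ^ 4, fun n ⟨k, hk⟩ hn m hm hm' μ hμ hA hE => ?_⟩
  subst hk
  have hp4 : 1 < p ^ 4 := Nat.one_lt_pow (by norm_num) hp.one_lt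
  have hn0 : k + k ≠ 0 := by omega
  set D := Nat.log (p ^ 4) (k + k)
  have hD0 : D ≠ 0 := (Nat.log_pos hp4 hn).ne'
  have hle : (p ^ D) ^ 4 ≤ k + k := by
    rw [← pow_mul, mul_comm, pow_mul]
    exact Nat.pow_log_le_self _ hn0
  have hlt : k + k ≤ (p * p ^ D) ^ 4 := by
    rw [← pow_succ', ← pow_mul, mul_comm, pow_mul]
    exact (Nat.lt_pow_succ_log_self hp4 _).le
  have hD : D ≤ k := by
    have h1 : D < p ^ D := D.lt_pow_self hp.one_lt
    have h2 : 2 * p ^ D ≤ (p ^ D) ^ 4 := by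
      have : 2 ≤ p ^ D := hp.two_le.trans (Nat.le_self_pow hD0 p)
      nlinarith [Nat.pow_le_pow_left this 3]
    omega
  obtain ⟨a, b, hab, N, B, hB, hN, hG⟩ :=
    exists_isUnit_commutator_card_vanishing_ge p hD0 hD hm μ hμ
  refine ⟨a, b, hab, ?_⟩
  have hEcard : (Finset.univ.filter fun i : Fin m => (k + k) ^ 2 ≤ i.val ∧ μ i 1 = 0).card ≤
      9 * (k + k) ^ 2 := by
    have h1 : (Finset.univ.filter fun i : Fin m => (k + k) ^ 2 ≤ i.val ∧ μ i 1 = 0).card ≤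
        (Finset.Ico ((k + k) ^ 2) m).card :=
      Finset.card_le_card_of_injOn Fin.val (fun i hi => by simp_all) Fin.val_injective.injOn
    rw [Nat.card_Ico] at h1
    omega
  have hN' : ((Finset.univ.filter fun i : Fin m => (k + k) ^ 2 ≤ i.val ∧ μ i 1 = 0).card : ℝ) *
      ((p ^ D : ℝ) / p - 1) ^ 2 ≤ ((p ^ D : ℝ) - 1) ^ 2 * N := by
    have h1 : (p ^ D : ℝ) / p = ((p ^ (D - 1) : ℕ) : ℝ) := by
      rw [div_eq_iff (by exact_mod_cast hp.ne_zero), Nat.cast_pow, ← pow_succ,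
        Nat.sub_add_cancel (Nat.one_le_iff_ne_zero.2 hD0)]
    rw [h1, ← Nat.cast_pow, ← Nat.cast_pred (pow_pos hp.pos _), ← Nat.cast_pred (pow_pos hp.pos _)]
    exact_mod_cast hN
  refine vanishing_count_estimate (T := (p : ℝ) ^ D) (N := N) (B := B) (by exact_mod_cast hp.two_le)
    (by exact_mod_cast Nat.le_self_pow hD0 p) (by exact_mod_cast Nat.one_le_iff_ne_zero.2 hn0)
    (by exact_mod_cast hle) (by exact_mod_cast hlt) hC₁.le (Nat.cast_nonneg _)
    (by exact_mod_cast hEcard) (Nat.cast_nonneg _) hA hE ?_ hN' (by exact_mod_cast hG)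
  rw [← pow_mul, mul_comm D 2]
  exact_mod_cast hB
end

section
/- Let p be a prime, let n be an even positive integer and let k be a positive integer with p^(n/2) > 4·C(k,3). Let μ_1,…,μ_{n²} be n² linearly independent linear forms on M_n(GF(p)). Then there exist k matrices a_1,…,a_k ∈ M_n(GF(p)) such that for all i < j < l the commutator [a_i − a_l, a_j − a_l] is invertible, and there exists a subset S ⊆ {1,…,n²} with |S| ≥ n² − 2·C(k,3)·n such that μ_i(a_j) = 0 for every i ∈ S and every j ∈ {1,…,k}. -/
namespace MvPolynomial

/-- A polynomial of total degree `d` that does not vanish at `x` does not vanish at some point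
obtained from `x` by keeping at most `d` coordinates and replacing the others by zero. -/
theorem exists_card_le_totalDegree_eval_ne_zero {σ R : Type*} [Fintype σ] [DecidableEq σ]
    [CommRing R] (P : MvPolynomial σ R) (x : σ → R) (hx : eval x P ≠ 0) :
    ∃ T : Finset σ, T.card ≤ P.totalDegree ∧ eval (fun i => if i ∈ T then x i else 0) P ≠ 0 := by
  obtain ⟨T, hT, hmin⟩ := exists_minimal_of_wellFoundedLT
    (fun T : Finset σ => eval (fun i => if i ∈ T then x i else 0) P ≠ 0)
    ⟨Finset.univ, by simpa using hx⟩
  refine ⟨T, ?_, hT⟩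
  by_contra! hcard
  have hsum : ∑ U ∈ T.powerset,
      (-1) ^ U.card * eval (fun i => if i ∈ U then x i else 0) P = 0 := by
    simp_rw [eval_eq', Finset.mul_sum]
    rw [Finset.sum_comm]
    refine Finset.sum_eq_zero fun d hd => ?_
    obtain ⟨i, hiT, hid⟩ : ∃ i ∈ T, d i = 0 := by
      by_contra! h
      have h1 : T.card ≤ d.degree := by
        calc T.card = ∑ i ∈ T, 1 := by simp
          _ ≤ ∑ i ∈ T, d i := Finset.sum_le_sum fun i hi => Nat.one_le_iff_ne_zero.mpr (h i hi)
          _ ≤ ∑ i, d i := Finset.sum_le_sum_of_subset (Finset.subset_univ T)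
          _ = d.degree := (Finsupp.degree_eq_sum d).symm
      have h2 : d.degree ≤ P.totalDegree := le_totalDegree hd
      omega
    rw [← Finset.insert_erase hiT, Finset.sum_powerset_insert (Finset.notMem_erase i T),
      ← Finset.sum_add_distrib]
    refine Finset.sum_eq_zero fun U hU => ?_
    have hiU : i ∉ U := fun h => Finset.notMem_erase i T (Finset.mem_powerset.mp hU h)
    have hprod : ∏ j, (if j ∈ insert i U then x j else 0) ^ d j =
        ∏ j, (if j ∈ U then x j else 0) ^ d j := by
      refine Finset.prod_congr rfl fun j _ => ?_
      by_cases hj : j = i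
      · simp [hj, hid]
      · simp [hj]
    rw [hprod, Finset.card_insert_of_notMem hiU]
    ring
  rw [Finset.sum_eq_single_of_mem T (Finset.mem_powerset_self T)] at hsum
  · rcases neg_one_pow_eq_or R T.card with h | h <;> simp [h] at hsum <;> exact hT hsum
  · intro U hU hne
    rw [not_not.mp fun h => hne
      (subset_antisymm (Finset.mem_powerset.mp hU) (hmin h (Finset.mem_powerset.mp hU))), mul_zero]

theorem totalDegree_det_le_s17 {σ R ι : Type*} [CommRing R] [Fintype ι] [DecidableEq ι]
    (M : Matrix ι ι (MvPolynomial σ R)) (d : ℕ) (hM : ∀ i j, (M i j).totalDegree ≤ d) :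
    M.det.totalDegree ≤ Fintype.card ι * d := by
  rw [Matrix.det_apply']
  refine totalDegree_finsetSum_le fun τ _ => ?_
  have hsign : ((Equiv.Perm.sign τ : ℤ) : MvPolynomial σ R).totalDegree = 0 := by
    rw [← map_intCast (C : R →+* MvPolynomial σ R), totalDegree_C]
  refine (totalDegree_mul _ _).trans ?_
  rw [hsign, zero_add]
  refine (totalDegree_finsetProd _ _).trans ?_
  exact (Finset.sum_le_card_nsmul _ _ d fun i _ => hM _ _).trans (by simp)

theorem totalDegree_mul_apply_le {σ R ι : Type*} [CommRing R] [Fintype ι]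
    (M N : Matrix ι ι (MvPolynomial σ R)) (d e : ℕ) (hM : ∀ i j, (M i j).totalDegree ≤ d)
    (hN : ∀ i j, (N i j).totalDegree ≤ e) (i j : ι) : ((M * N) i j).totalDegree ≤ d + e := by
  rw [Matrix.mul_apply]
  exact totalDegree_finsetSum_le fun l _ =>
    (totalDegree_mul _ _).trans (Nat.add_le_add (hM i l) (hN l j))

end MvPolynomial

/-- For distinct `t` in the field with `p ^ m` elements, embedded in the `m × m` matrices over
`ZMod p`, the block matrices `!![0, t; t ^ 2, 0]` have invertible triplewise commutators. -/
theorem exists_matrices_isUnit_commutators (p : ℕ) [Fact p.Prime] (m k : ℕ) (hm : m ≠ 0)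
    (hk : k ≤ p ^ m) :
    ∃ a : Fin k → Matrix (Fin (m + m)) (Fin (m + m)) (ZMod p),
      ∀ i j l : Fin k, i < j → j < l →
        IsUnit ((a i - a l) * (a j - a l) - (a j - a l) * (a i - a l)) := by
  let K := GaloisField p m
  obtain ⟨f⟩ : Nonempty (Fin k ↪ K) := by
    have := Fintype.ofFinite K
    rw [Function.Embedding.nonempty_iff_card_le, Fintype.card_fin, ← Nat.card_eq_fintype_card,
      GaloisField.card p m hm]
    exact hk
  let φ := Algebra.leftMulMatrix (Module.finBasisOfFinrankEq (ZMod p) K (GaloisField.finrank p hm))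
  let ψ := Matrix.reindexAlgEquiv (ZMod p) (ZMod p) (finSumFinEquiv (m := m) (n := m))
  let B : K → Matrix (Fin m ⊕ Fin m) (Fin m ⊕ Fin m) (ZMod p) :=
    fun t => Matrix.fromBlocks 0 (φ t) (φ (t ^ 2)) 0
  refine ⟨fun i => ψ (B (f i)), fun i j l hij hjl => ?_⟩
  simp only [← map_sub, ← map_mul]
  refine IsUnit.map ψ ?_
  have hsub (s t : K) : B s - B t = Matrix.fromBlocks 0 (φ (s - t)) (φ (s ^ 2 - t ^ 2)) 0 := by
    simp only [B, sub_eq_add_neg, Matrix.fromBlocks_neg, Matrix.fromBlocks_add, map_add, map_neg,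
      neg_zero, add_zero]
  have hB : (B (f i) - B (f l)) * (B (f j) - B (f l)) - (B (f j) - B (f l)) * (B (f i) - B (f l)) =
      Matrix.fromBlocks (φ ((f i - f l) * (f j - f l) * (f j - f i))) 0 0
        (φ (-((f i - f l) * (f j - f l) * (f j - f i)))) := by
    simp only [hsub, Matrix.fromBlocks_multiply, mul_zero, zero_mul, zero_add, add_zero]
    rw [sub_eq_add_neg, Matrix.fromBlocks_neg, Matrix.fromBlocks_add]
    simp only [← map_mul, ← map_neg, ← map_add, neg_zero, add_zero]
    congr 2 <;> ring
  have hne {s t : Fin k} (h : s ≠ t) : f s - f t ≠ 0 := sub_ne_zero.mpr (f.injective.ne h)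
  have hu : IsUnit ((f i - f l) * (f j - f l) * (f j - f i)) :=
    (mul_ne_zero (mul_ne_zero (hne (hij.trans hjl).ne) (hne hjl.ne)) (hne hij.ne')).isUnit
  rw [hB, Matrix.isUnit_fromBlocks_zero₂₁]
  exact ⟨hu.map φ, hu.neg.map φ⟩

theorem card_filter_lt_lt_le (k : ℕ) :
    (Finset.univ.filter fun t : Fin k × Fin k × Fin k => t.1 < t.2.1 ∧ t.2.1 < t.2.2).card ≤
      k.choose 3 := by
  have h3 : (Finset.powersetCard 3 (Finset.univ : Finset (Fin k))).card = k.choose 3 := by simp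
  rw [← h3]
  refine Finset.card_le_card_of_injOn (fun t => {t.1, t.2.1, t.2.2}) ?_ ?_
  · rintro ⟨i, j, l⟩ h
    simp only [Finset.coe_filter, Finset.mem_univ, true_and, Set.mem_ofPred_eq] at h
    rw [Finset.mem_coe, Finset.mem_powersetCard]
    exact ⟨Finset.subset_univ _, Finset.card_eq_three.mpr
      ⟨i, j, l, h.1.ne, (h.1.trans h.2).ne, h.2.ne, rfl⟩⟩
  · rintro ⟨i, j, l⟩ h ⟨i', j', l'⟩ h' heq
    simp only [Finset.coe_filter, Finset.mem_univ, true_and, Set.mem_ofPred_eq] at h h'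
    simp only [Finset.ext_iff, Finset.mem_insert, Finset.mem_singleton] at heq
    have := heq i
    have := heq j
    have := heq l
    have := heq i'
    have := heq j'
    have := heq l'
    simp only [Prod.mk.injEq]
    omega

theorem le_of_four_mul_choose_three_lt {k q : ℕ} (hq : 2 ≤ q) (h : 4 * k.choose 3 < q) :
    k ≤ q := by
  rcases Nat.lt_or_ge k 3 with hk | hk
  · omega
  · have h1 : k.choose 3 ≥ k - 2 := by
      obtain ⟨r, rfl⟩ := Nat.exists_eq_add_of_le hk
      clear h hq hk
      induction r with
      | zero => simp
      | succ r ih =>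
        have h2 := Nat.choose_succ_succ (3 + r) 2
        have h3 : 0 < (3 + r).choose 2 := Nat.choose_pos (by omega)
        have h4 : (3 + (r + 1)).choose 3 = (3 + r).choose 2 + (3 + r).choose 3 := h2
        omega
    omega

/-- Linearly independent forms, as many as the dimension, are a coordinate system. -/
theorem LinearIndependent.exists_linearEquiv_pi {K V ι : Type*} [Field K] [AddCommGroup V]
    [Module K V] [FiniteDimensional K V] [Fintype ι] {μ : ι → Module.Dual K V}
    (hμ : LinearIndependent K μ) (hcard : Fintype.card ι = Module.finrank K V) :
    ∃ φ : V ≃ₗ[K] (ι → K), ∀ v i, φ v i = μ i v := by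
  have hspan : Submodule.span K (Set.range μ) = ⊤ :=
    hμ.span_eq_top_of_card_eq_finrank' (by rw [hcard, Subspace.dual_finrank_eq])
  have hinj : Function.Injective (LinearMap.pi μ) := by
    rw [← LinearMap.ker_eq_bot, LinearMap.ker_eq_bot']
    intro v hv
    rw [← Module.forall_dual_apply_eq_zero_iff K]
    intro g
    have hg : g ∈ Submodule.span K (Set.range μ) := hspan ▸ Submodule.mem_top
    induction hg using Submodule.span_induction with
    | mem g hg => obtain ⟨i, rfl⟩ := hg; exact congrFun hv i
    | zero => simp
    | add g h _ _ hg hh => simp [hg, hh]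
    | smul c g _ hg => simp [hg]
  exact ⟨LinearEquiv.ofInjectiveOfFinrankEq (LinearMap.pi μ) hinj (by simp [hcard]),
    fun v i => rfl⟩

/-- For even n with p^(n/2) > 4·C(k,3) and n² linearly
independent linear forms on M_n(GF(p)), there are k matrices whose triplewise
commutators [a_i − a_l, a_j − a_l] are invertible, and at least
n² − 2·C(k,3)·n of the forms vanish on all of them. -/
theorem exists_matrices_invertible_commutators_with_vanishing_forms
    (p : ℕ) [Fact p.Prime] (n k : ℕ) (hn : 1 ≤ n) (hne : Even n) (hk : 1 ≤ k)
    (hpk : 4 * k.choose 3 < p ^ (n / 2))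
    (μ : Fin (n ^ 2) → (Matrix (Fin n) (Fin n) (ZMod p) →ₗ[ZMod p] ZMod p))
    (hμ : LinearIndependent (ZMod p) μ) :
    ∃ a : Fin k → Matrix (Fin n) (Fin n) (ZMod p),
      (∀ i j l : Fin k, i < j → j < l →
        IsUnit ((a i - a l) * (a j - a l) - (a j - a l) * (a i - a l))) ∧
      ∃ S : Finset (Fin (n ^ 2)),
        (n : ℤ) ^ 2 - 2 * (k.choose 3 : ℤ) * (n : ℤ) ≤ (S.card : ℤ) ∧
        ∀ i ∈ S, ∀ j : Fin k, μ i (a j) = 0 := by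
  obtain ⟨φ, hφ⟩ := hμ.exists_linearEquiv_pi (by simp [Module.finrank_matrix, sq])
  obtain ⟨b, hb⟩ : ∃ b : Fin k → Matrix (Fin n) (Fin n) (ZMod p), ∀ i j l : Fin k, i < j → j < l →
      IsUnit ((b i - b l) * (b j - b l) - (b j - b l) * (b i - b l)) := by
    obtain ⟨m, rfl⟩ := hne
    have hm : m ≠ 0 := by omega
    rw [show (m + m) / 2 = m by omega] at hpk
    exact exists_matrices_isUnit_commutators p m k hm (le_of_four_mul_choose_three_lt
      ((Fact.out : p.Prime).two_le.trans (Nat.le_self_pow hm p)) hpk)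
  let e : Fin (n ^ 2) → Matrix (Fin n) (Fin n) (ZMod p) := fun i => φ.symm (Pi.single i 1)
  let A : Fin k → Matrix (Fin n) (Fin n) (MvPolynomial (Fin (n ^ 2)) (ZMod p)) := fun j =>
    Matrix.of fun r c => ∑ i, MvPolynomial.C (μ i (b j) * e i r c) * MvPolynomial.X i
  let D : Fin k × Fin k × Fin k → Matrix (Fin n) (Fin n) (MvPolynomial (Fin (n ^ 2)) (ZMod p)) :=
    fun t => (A t.1 - A t.2.2) * (A t.2.1 - A t.2.2) - (A t.2.1 - A t.2.2) * (A t.1 - A t.2.2)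
  let I := Finset.univ.filter fun t : Fin k × Fin k × Fin k => t.1 < t.2.1 ∧ t.2.1 < t.2.2
  let P := ∏ t ∈ I, (D t).det
  let ev : (Fin (n ^ 2) → ZMod p) → Fin k → Matrix (Fin n) (Fin n) (ZMod p) :=
    fun y j => φ.symm fun i => y i * μ i (b j)
  have hA (y j) : (MvPolynomial.eval y).mapMatrix (A j) = ev y j := by
    have : ev y j = ∑ i, (y i * μ i (b j)) • e i := by
      simp only [ev, e, ← map_smul, ← map_sum]
      congr 1
      ext i
      simp [Finset.sum_apply, Pi.single_apply]
    rw [this]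
    ext r c
    simp only [A, RingHom.mapMatrix_apply, Matrix.map_apply, Matrix.of_apply, map_sum, map_mul,
      MvPolynomial.eval_C, MvPolynomial.eval_X, Matrix.sum_apply, Matrix.smul_apply, smul_eq_mul]
    exact Finset.sum_congr rfl fun i _ => by ring
  have hP (y) : MvPolynomial.eval y P ≠ 0 ↔ ∀ i j l : Fin k, i < j → j < l →
      IsUnit ((ev y i - ev y l) * (ev y j - ev y l) - (ev y j - ev y l) * (ev y i - ev y l)) := by
    simp only [P, I, D, map_prod, RingHom.map_det, map_sub, map_mul, hA, Finset.prod_ne_zero_iff,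
      Matrix.isUnit_iff_isUnit_det, isUnit_iff_ne_zero, Finset.mem_filter, Finset.mem_univ,
      true_and, Prod.forall, and_imp]
  have hdeg : P.totalDegree ≤ k.choose 3 * (n * 2) := by
    have hA1 (j r c) : (A j r c).totalDegree ≤ 1 := by
      simp only [A, Matrix.of_apply]
      refine MvPolynomial.totalDegree_finsetSum_le fun i _ => ?_
      refine (MvPolynomial.totalDegree_mul _ _).trans ?_
      rw [MvPolynomial.totalDegree_C, MvPolynomial.totalDegree_X]
    have hA2 (i j r c) : ((A i - A j) r c).totalDegree ≤ 1 := by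
      rw [Matrix.sub_apply]
      exact (MvPolynomial.totalDegree_sub _ _).trans (max_le (hA1 i r c) (hA1 j r c))
    have hD (t r c) : (D t r c).totalDegree ≤ 2 := by
      simp only [D]
      rw [Matrix.sub_apply]
      exact (MvPolynomial.totalDegree_sub _ _).trans (max_le
        (MvPolynomial.totalDegree_mul_apply_le _ _ 1 1 (hA2 _ _) (hA2 _ _) r c)
        (MvPolynomial.totalDegree_mul_apply_le _ _ 1 1 (hA2 _ _) (hA2 _ _) r c))
    calc P.totalDegree ≤ ∑ t ∈ I, (D t).det.totalDegree := MvPolynomial.totalDegree_finsetProd _ _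
      _ ≤ I.card • (n * 2) := Finset.sum_le_card_nsmul _ _ _ fun t _ => by
        simpa using MvPolynomial.totalDegree_det_le_s17 (D t) 2 (hD t)
      _ ≤ k.choose 3 * (n * 2) := Nat.mul_le_mul_right _ (card_filter_lt_lt_le k)
  have hev1 : ev (fun _ => 1) = b := by
    ext1 j
    simp only [ev, one_mul, ← hφ]
    exact φ.symm_apply_apply (b j)
  obtain ⟨T, hTcard, hT⟩ := P.exists_card_le_totalDegree_eval_ne_zero (fun _ => 1)
    ((hP _).mpr (by rwa [hev1]))
  refine ⟨ev _, (hP _).mp hT, Tᶜ, ?_, fun i hi j => ?_⟩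
  · have hle : (T.card : ℤ) ≤ k.choose 3 * (n * 2) := by exact_mod_cast hTcard.trans hdeg
    have hsum : (T.card : ℤ) + Tᶜ.card = n ^ 2 := by
      exact_mod_cast (T.card_add_card_compl).trans (Fintype.card_fin _)
    linarith
  · rw [← hφ, LinearEquiv.apply_symm_apply]
    simp [Finset.mem_compl.mp hi]
end

section
/- Let p be a prime, let n be an even positive integer and let k be a positive integer with p^(n/2) > 4·C(k,3). Then there exist k matrices a_1,…,a_k ∈ M_n(GF(p)) such that for all indices i < j < l the commutator [a_i − a_l, a_j − a_l] is an invertible matrix. -/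
open Matrix in
/-- Restriction of scalars along a basis `b` of a commutative algebra `K` over `F`, as a ring
homomorphism between matrix rings. -/
theorem exists_matrix_ringHom_of_basis {F K ι : Type*} [CommRing F] [CommRing K] [Algebra F K]
    [Fintype ι] [DecidableEq ι] (b : Module.Basis ι F K) {n d : ℕ}
    (hn : n = d * Fintype.card ι) :
    Nonempty (Matrix (Fin d) (Fin d) K →+* Matrix (Fin n) (Fin n) F) := by
  have e : Fin d × ι ≃ Fin n := Fintype.equivFinOfCardEq (by simp [hn])
  exact ⟨((reindexAlgEquiv F F e).toRingEquiv.toRingHom.comp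
    (compRingEquiv (Fin d) ι F).toRingHom).comp
      (Algebra.leftMulMatrix b).toRingHom.mapMatrix⟩

theorem Nat.le_four_mul_choose_three {k : ℕ} (hk : 3 ≤ k) : k ≤ 4 * k.choose 3 := by
  induction k, hk using Nat.le_induction with
  | base => decide
  | succ k hk ih =>
    have h1 : (k + 1).choose 3 = k.choose 2 + k.choose 3 := Nat.choose_succ_succ k 2
    have h2 : 0 < k.choose 2 := Nat.choose_pos (by omega)
    omega

/-- For distinct scalars, the matrices `!![0, t; t ^ 2, 0]` have invertible commutators of
differences: the commutator is a Vandermonde determinant times `diag(1, -1)`. -/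
theorem isUnit_commutator_antidiagonal {K : Type*} [Field K] {x y z : K}
    (hxy : x ≠ y) (hyz : y ≠ z) (hxz : x ≠ z) :
    IsUnit ((!![0, x; x ^ 2, 0] - !![0, z; z ^ 2, 0]) * (!![0, y; y ^ 2, 0] - !![0, z; z ^ 2, 0])
      - (!![0, y; y ^ 2, 0] - !![0, z; z ^ 2, 0]) * (!![0, x; x ^ 2, 0] - !![0, z; z ^ 2, 0])) := by
  rw [Matrix.isUnit_iff_isUnit_det, isUnit_iff_ne_zero]
  have h : ((x - y) * (y - z) * (x - z)) ^ 2 ≠ 0 :=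
    pow_ne_zero _ (mul_ne_zero (mul_ne_zero (sub_ne_zero.2 hxy) (sub_ne_zero.2 hyz))
      (sub_ne_zero.2 hxz))
  contrapose! h
  simp [Matrix.det_fin_two, -mul_eq_zero] at h
  linear_combination -h

/-- For even n with p^(n/2) > 4·C(k,3) there are k matrices in
M_n(GF(p)) such that all the commutators [a_i − a_l, a_j − a_l] (i < j < l)
are invertible. -/
theorem exists_matrices_with_invertible_commutators
    (p : ℕ) [Fact p.Prime] (n k : ℕ) (hn : 1 ≤ n) (hne : Even n) (hk : 1 ≤ k)
    (hpk : 4 * k.choose 3 < p ^ (n / 2)) :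
    ∃ a : Fin k → Matrix (Fin n) (Fin n) (ZMod p),
      ∀ i j l : Fin k, i < j → j < l →
        IsUnit ((a i - a l) * (a j - a l) - (a j - a l) * (a i - a l)) := by
  rcases lt_or_ge k 3 with hk3 | hk3
  · exact ⟨0, fun i j l hij hjl => by omega⟩
  have hm : n / 2 ≠ 0 := by obtain ⟨m, rfl⟩ := hne; omega
  have := Fintype.ofFinite (GaloisField p (n / 2))
  obtain ⟨t⟩ : Nonempty (Fin k ↪ GaloisField p (n / 2)) := by
    rw [Function.Embedding.nonempty_iff_card_le, Fintype.card_fin, ← Nat.card_eq_fintype_card,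
      GaloisField.card p _ hm]
    exact (Nat.le_four_mul_choose_three hk3).trans hpk.le
  have : Module.Free (ZMod p) (GaloisField p (n / 2)) := Module.Free.of_divisionRing _ _
  obtain ⟨f⟩ := exists_matrix_ringHom_of_basis
    (Module.finBasis (ZMod p) (GaloisField p (n / 2))) (n := n) (d := 2) (by
      rw [Fintype.card_fin, GaloisField.finrank p hm, Nat.two_mul_div_two_of_even hne])
  refine ⟨fun i => f !![0, t i; t i ^ 2, 0], fun i j l hij hjl => ?_⟩
  simpa only [map_sub, map_mul] using (isUnit_commutator_antidiagonal
    (t.injective.ne hij.ne) (t.injective.ne hjl.ne) (t.injective.ne (hij.trans hjl).ne)).map f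
end
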